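/- The critical value satisfies ε(P) = inf{ε ≥ 0 : 𝓜_ε(P) ≠ ∅}, where both infima are taken in [0,∞] with inf ∅ = +∞. -/

import Mathlib

open MeasureTheory Filter
open scoped ENNReal NNReal

noncomputable section

namespace QFTAP

/-- The `p`-norm on `ℝ^d`. -/
def pNorm {d : ℕ} (p : ℝ) (x : Fin d → ℝ) : ℝ := (∑ i, |x i| ^ p) ^ (1 / p)

/-- The norm dual to the `p`-norm, i.e. the `q`-norm where `1/p + 1/q = 1`
(`q = ∞` when `p = 1`, and `q = p/(p-1)` when `p > 1`). -/
def qNorm {d : ℕ} (p : ℝ) (x : Fin d → ℝ) : ℝ :=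
  if p = 1 then ⨆ i, |x i| else pNorm (p / (p - 1)) x

/-- Euclidean scalar product on `ℝ^d`. -/
def dot {d : ℕ} (x y : Fin d → ℝ) : ℝ := ∑ i, x i * y i

/-- The dual vector `x*` (with the convention `0* = 0`): `x*_i = sgn(x_i) |x_i|^{p-1} / |x|_p^{p-1}`. -/
def dualVec {d : ℕ} (p : ℝ) (x : Fin d → ℝ) : Fin d → ℝ :=
  fun i => Real.sign (x i) * |x i| ^ (p - 1) / (pNorm p x) ^ (p - 1)

variable {Ω : Type*} [mΩ : MeasurableSpace Ω] {d : ℕ}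

/-- A trading strategy: `H t` is `ℱ (t-1)`-measurable for every `t ≥ 1`. -/
def IsStrategy (ℱ : Filtration ℕ mΩ) (H : ℕ → Ω → Fin d → ℝ) : Prop :=
  ∀ t : ℕ, 1 ≤ t → StronglyMeasurable[ℱ (t - 1)] (H t)

/-- The terminal gain `(H • S)_T = ∑_{t=1}^T H_t · ΔS_t`. -/
def gain (S H : ℕ → Ω → Fin d → ℝ) (T : ℕ) (ω : Ω) : ℝ :=
  ∑ t ∈ Finset.Icc 1 T, dot (H t ω) (S t ω - S (t - 1) ω)

/-- `‖H‖_p = ∑_{t=1}^T |H_t|_p`. -/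
def stratNorm (p : ℝ) (H : ℕ → Ω → Fin d → ℝ) (T : ℕ) (ω : Ω) : ℝ :=
  ∑ t ∈ Finset.Icc 1 T, pNorm p (H t ω)

/-- `H` is a strict `ε`-arbitrage. -/
def IsStrictArb (P : Measure Ω) (ℱ : Filtration ℕ mΩ) (S : ℕ → Ω → Fin d → ℝ) (T : ℕ)
    (p ε : ℝ) (H : ℕ → Ω → Fin d → ℝ) : Prop :=
  IsStrategy ℱ H ∧
    (∀ᵐ ω ∂P, 0 ≤ gain S H T ω - ε * stratNorm p H T ω) ∧
    0 < P {ω | 0 < gain S H T ω - ε * stratNorm p H T ω}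

/-- A sequence of trading strategies is an `ε`-arbitrage. -/
def IsArb (P : Measure Ω) (ℱ : Filtration ℕ mΩ) (S : ℕ → Ω → Fin d → ℝ) (T : ℕ)
    (p ε : ℝ) (H : ℕ → ℕ → Ω → Fin d → ℝ) : Prop :=
  (∀ k, IsStrategy ℱ (H k)) ∧
    (∀ᵐ ω ∂P, 0 ≤ atTop.liminf fun k => gain S (H k) T ω - ε * stratNorm p (H k) T ω) ∧
    0 < P {ω | 0 < atTop.liminf fun k => gain S (H k) T ω - ε * stratNorm p (H k) T ω}

/-- The market satisfies `NA_ε`: there is no `ε`-arbitrage. -/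
def NA (P : Measure Ω) (ℱ : Filtration ℕ mΩ) (S : ℕ → Ω → Fin d → ℝ) (T : ℕ) (p ε : ℝ) : Prop :=
  ¬ ∃ H, IsArb P ℱ S T p ε H

/-- The critical value `ε(P) = inf {ε > 0 : no strict ε-arbitrage}`, with `inf ∅ = ∞`. -/
def criticalValue (P : Measure Ω) (ℱ : Filtration ℕ mΩ) (S : ℕ → Ω → Fin d → ℝ) (T : ℕ)
    (p : ℝ) : ℝ≥0∞ :=
  sInf {x : ℝ≥0∞ | ∃ ε : ℝ, 0 < ε ∧ (¬ ∃ H, IsStrictArb P ℱ S T p ε H) ∧ x = ENNReal.ofReal ε}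

/-- `Q` is an `ε`-martingale measure: `Q` is a probability measure equivalent to `P`,
`S_T ∈ L¹(Q)` and `|E_Q[S_t | ℱ_{t-1}] - S_{t-1}|_q ≤ ε` a.s. for all `t = 1,…,T`. -/
def IsEpsMartMeasure (P : Measure Ω) (ℱ : Filtration ℕ mΩ) (S : ℕ → Ω → Fin d → ℝ) (T : ℕ)
    (p ε : ℝ) (Q : Measure Ω) : Prop :=
  IsProbabilityMeasure Q ∧ Q ≪ P ∧ P ≪ Q ∧ Integrable (S T) Q ∧
    ∀ t : ℕ, 1 ≤ t → t ≤ T →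
      ∀ᵐ ω ∂Q, qNorm p ((Q[S t | ℱ (t - 1)]) ω - S (t - 1) ω) ≤ ε

/-- `𝓜_ε(P)`: the `ε`-martingale measures with `P`-essentially bounded density `dQ/dP`. -/
def Meps (P : Measure Ω) (ℱ : Filtration ℕ mΩ) (S : ℕ → Ω → Fin d → ℝ) (T : ℕ)
    (p ε : ℝ) : Set (Measure Ω) :=
  {Q | IsEpsMartMeasure P ℱ S T p ε Q ∧ ∃ C : ℝ≥0, ∀ᵐ ω ∂P, Q.rnDeriv P ω ≤ C}

/-- `K = {(H•S)_T - ε ‖H‖_p : H ∈ 𝓗}`. -/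
def Kset (ℱ : Filtration ℕ mΩ) (S : ℕ → Ω → Fin d → ℝ) (T : ℕ) (p ε : ℝ) : Set (Ω → ℝ) :=
  {X | ∃ H, IsStrategy ℱ H ∧ X = fun ω => gain S H T ω - ε * stratNorm p H T ω}

/-- `K̄`: the closure of `K` with respect to convergence in `P`-probability. -/
def Kbar (P : Measure Ω) (ℱ : Filtration ℕ mΩ) (S : ℕ → Ω → Fin d → ℝ) (T : ℕ)
    (p ε : ℝ) : Set (Ω → ℝ) :=
  {X | ∃ Y : ℕ → Ω → ℝ, (∀ n, Y n ∈ Kset ℱ S T p ε) ∧ TendstoInMeasure P Y atTop X}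

/-- `C = {X : ∃ Y ∈ K̄, X ≤ Y a.s.}`. -/
def Cset (P : Measure Ω) (ℱ : Filtration ℕ mΩ) (S : ℕ → Ω → Fin d → ℝ) (T : ℕ)
    (p ε : ℝ) : Set (Ω → ℝ) :=
  {X | ∃ Y ∈ Kbar P ℱ S T p ε, ∀ᵐ ω ∂P, X ω ≤ Y ω}

/-- `E_{ε,t} = {H_t ∈ 𝓗_t : H_t · ΔS_t = ε |H_t|_p a.s.}`. -/
def Eset (P : Measure Ω) (ℱ : Filtration ℕ mΩ) (S : ℕ → Ω → Fin d → ℝ)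
    (p ε : ℝ) (t : ℕ) : Set (Ω → Fin d → ℝ) :=
  {h | StronglyMeasurable[ℱ (t - 1)] h ∧
    ∀ᵐ ω ∂P, dot (h ω) (S t ω - S (t - 1) ω) = ε * pNorm p (h ω)}

/-- `E_{0,t} = {H_t ∈ 𝓗_t : H_t · ΔS_t = 0 a.s.}`. -/
def E0set (P : Measure Ω) (ℱ : Filtration ℕ mΩ) (S : ℕ → Ω → Fin d → ℝ)
    (t : ℕ) : Set (Ω → Fin d → ℝ) :=
  {h | StronglyMeasurable[ℱ (t - 1)] h ∧
    ∀ᵐ ω ∂P, dot (h ω) (S t ω - S (t - 1) ω) = 0}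

/-- `E_{0,t}^⊥`. -/
def E0perp (P : Measure Ω) (ℱ : Filtration ℕ mΩ) (S : ℕ → Ω → Fin d → ℝ)
    (t : ℕ) : Set (Ω → Fin d → ℝ) :=
  {h | StronglyMeasurable[ℱ (t - 1)] h ∧
    ∀ g ∈ E0set P ℱ S t, ∀ᵐ ω ∂P, dot (h ω) (g ω) = 0}

/-- `F_{ε,t} = {X_t ∈ 𝓗_t : X_t · H_t = |X_t|_q |H_t|_p a.s. for every H_t ∈ E_{ε,t}}`. -/
def Fset (P : Measure Ω) (ℱ : Filtration ℕ mΩ) (S : ℕ → Ω → Fin d → ℝ)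
    (p ε : ℝ) (t : ℕ) : Set (Ω → Fin d → ℝ) :=
  {X | StronglyMeasurable[ℱ (t - 1)] X ∧
    ∀ h ∈ Eset P ℱ S p ε t, ∀ᵐ ω ∂P, dot (X ω) (h ω) = qNorm p (X ω) * pNorm p (h ω)}

/-- `F_{ε,t}^⊥`, depending on a fixed maximal element `H̄_t` of `E_{ε,t}` when `p = 1`. -/
def Fperp (P : Measure Ω) (ℱ : Filtration ℕ mΩ) (S : ℕ → Ω → Fin d → ℝ)
    (p ε : ℝ) (t : ℕ) (Hb : Ω → Fin d → ℝ) : Set (Ω → Fin d → ℝ) :=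
  if p = 1 then
    {h | StronglyMeasurable[ℱ (t - 1)] h ∧
      (∀ᵐ ω ∂P, dot (dualVec 1 (Hb ω)) (h ω) = 0) ∧
      ∀ i, ∀ᵐ ω ∂P, Hb ω i = 0 → h ω i = 0}
  else
    {h | StronglyMeasurable[ℱ (t - 1)] h ∧
      ∀ X ∈ Fset P ℱ S p ε t, ∀ᵐ ω ∂P, dot (X ω) (h ω) = 0}

/-- `𝓗̄_t`: strategies supported on the support of `H̄_t` (componentwise when `p = 1`). -/
def HbarSpace (P : Measure Ω) (ℱ : Filtration ℕ mΩ) (p : ℝ) (t : ℕ)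
    (Hb : Ω → Fin d → ℝ) : Set (Ω → Fin d → ℝ) :=
  if p = 1 then
    {h | StronglyMeasurable[ℱ (t - 1)] h ∧ ∀ i, ∀ᵐ ω ∂P, Hb ω i = 0 → h ω i = 0}
  else
    {h | StronglyMeasurable[ℱ (t - 1)] h ∧ ∀ᵐ ω ∂P, Hb ω = 0 → h ω = 0}

/-- The defining properties of `H̄_t`: an element of `E_{ε,t}` with `|H̄_t|_p ∈ {0,1}` a.s. of
maximal support (componentwise maximal when `p = 1`). -/
def IsMaximalEps (P : Measure Ω) (ℱ : Filtration ℕ mΩ) (S : ℕ → Ω → Fin d → ℝ)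
    (p ε : ℝ) (t : ℕ) (Hb : Ω → Fin d → ℝ) : Prop :=
  Hb ∈ Eset P ℱ S p ε t ∧
    (∀ᵐ ω ∂P, pNorm p (Hb ω) = 0 ∨ pNorm p (Hb ω) = 1) ∧
    (1 < p → P {ω | Hb ω ≠ 0} = ⨆ h ∈ Eset P ℱ S p ε t, P {ω | h ω ≠ 0}) ∧
    (p = 1 → ∀ i, P {ω | Hb ω i ≠ 0} = ⨆ h ∈ Eset P ℱ S p ε t, P {ω | h ω i ≠ 0})

/-- `F_ε^⊥ = {G ∈ 𝓗 : G_t ∈ F_{ε,t}^⊥ for every t = 1,…,T}`. -/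
def FperpStrat (P : Measure Ω) (ℱ : Filtration ℕ mΩ) (S : ℕ → Ω → Fin d → ℝ) (T : ℕ)
    (p ε : ℝ) (Hb : ℕ → Ω → Fin d → ℝ) : Set (ℕ → Ω → Fin d → ℝ) :=
  {G | ∀ t, 1 ≤ t → t ≤ T → G t ∈ Fperp P ℱ S p ε t (Hb t)}

/-- The market satisfies `NA'_ε`. -/
def NAprime (P : Measure Ω) (ℱ : Filtration ℕ mΩ) (S : ℕ → Ω → Fin d → ℝ) (T : ℕ)
    (p ε : ℝ) (Hb : ℕ → Ω → Fin d → ℝ) : Prop :=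
  (¬ ∃ H, IsStrictArb P ℱ S T p ε H) ∧
    ∀ G ∈ FperpStrat P ℱ S T p ε Hb,
      (∀ᵐ ω ∂P, 0 ≤ gain S G T ω) → ∀ᵐ ω ∂P, gain S G T ω = 0

/-- `ψ` is an `ε`-fair price for `Ψ`. -/
def IsFairPrice (P : Measure Ω) (ℱ : Filtration ℕ mΩ) (S : ℕ → Ω → Fin d → ℝ) (T : ℕ)
    (p ε : ℝ) (Ψ : Ω → ℝ) (ψ : ℝ) : Prop :=
  ∀ (H : ℕ → ℕ → Ω → Fin d → ℝ) (a : ℕ → ℝ), (∀ k, IsStrategy ℱ (H k)) →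
    (∀ᵐ ω ∂P, 0 ≤ atTop.liminf fun k =>
      gain S (H k) T ω + a k * (Ψ ω - ψ) - ε * (stratNorm p (H k) T ω + |a k|)) →
    ∀ᵐ ω ∂P, atTop.liminf (fun k =>
      gain S (H k) T ω + a k * (Ψ ω - ψ) - ε * (stratNorm p (H k) T ω + |a k|)) = 0



lemma pNorm_nonneg (p : ℝ) (x : Fin d → ℝ) : 0 ≤ pNorm p x :=
  Real.rpow_nonneg (Finset.sum_nonneg fun _ _ => Real.rpow_nonneg (abs_nonneg _) _) _

lemma pNorm_smul {p : ℝ} (hp : 1 ≤ p) {c : ℝ} (hc : 0 ≤ c) (x : Fin d → ℝ) :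
    pNorm p (c • x) = c * pNorm p x := by
  unfold pNorm
  have h : ∀ i, |(c • x) i| ^ p = c ^ p * |x i| ^ p := fun i => by
    rw [Pi.smul_apply, smul_eq_mul, abs_mul, abs_of_nonneg hc,
      Real.mul_rpow hc (abs_nonneg _)]
  simp_rw [h]
  rw [← Finset.mul_sum, Real.mul_rpow (Real.rpow_nonneg hc _)
    (Finset.sum_nonneg fun _ _ => Real.rpow_nonneg (abs_nonneg _) _), ← Real.rpow_mul hc,
    mul_one_div_cancel (by linarith), Real.rpow_one]

lemma pNorm_zero {p : ℝ} (hp : 1 ≤ p) : pNorm p (0 : Fin d → ℝ) = 0 := by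
  simpa using pNorm_smul hp le_rfl (0 : Fin d → ℝ)

lemma abs_le_pNorm {p : ℝ} (hp : 1 ≤ p) (x : Fin d → ℝ) (i : Fin d) :
    |x i| ≤ pNorm p x := by
  unfold pNorm
  rw [one_div, Real.le_rpow_inv_iff_of_pos (abs_nonneg _)
    (Finset.sum_nonneg fun _ _ => Real.rpow_nonneg (abs_nonneg _) _) (by linarith)]
  exact Finset.single_le_sum (f := fun i => |x i| ^ p)
    (fun _ _ => Real.rpow_nonneg (abs_nonneg _) _) (Finset.mem_univ i)

lemma pNorm_single {p : ℝ} (hp : 1 ≤ p) (i : Fin d) (a : ℝ) :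
    pNorm p (Pi.single i a) = |a| := by
  unfold pNorm
  rw [Finset.sum_eq_single i]
  · rw [Pi.single_eq_same, one_div, Real.rpow_rpow_inv (abs_nonneg _) (by linarith)]
  · intro j _ hj
    rw [Pi.single_eq_of_ne hj, abs_zero, Real.zero_rpow (by linarith)]
  · simp

lemma continuous_pNorm {p : ℝ} (hp : 1 ≤ p) :
    Continuous (pNorm p : (Fin d → ℝ) → ℝ) := by
  unfold pNorm
  refine Continuous.rpow_const (continuous_finsetSum _ fun i _ =>
    (Continuous.rpow_const (by fun_prop) fun _ => Or.inr (by linarith)))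
    fun _ => Or.inr (by positivity)

lemma dot_single (i : Fin d) (a : ℝ) (v : Fin d → ℝ) :
    dot (Pi.single i a) v = a * v i := by
  unfold dot
  rw [Finset.sum_eq_single i] <;> simp +contextual

lemma dot_smul_left (c : ℝ) (x y : Fin d → ℝ) : dot (c • x) y = c * dot x y := by
  simp [dot, Finset.mul_sum, mul_assoc]

lemma dot_le_sum_abs_mul_pNorm {p : ℝ} (hp : 1 ≤ p) (x y : Fin d → ℝ) :
    dot x y ≤ (∑ i, |y i|) * pNorm p x := by
  unfold dot
  rw [Finset.sum_mul]
  refine Finset.sum_le_sum fun i _ => ?_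
  calc x i * y i ≤ |x i * y i| := le_abs_self _
    _ = |y i| * |x i| := by rw [abs_mul, mul_comm]
    _ ≤ _ := mul_le_mul_of_nonneg_left (abs_le_pNorm hp x i) (abs_nonneg _)

lemma pNorm_rpow {p : ℝ} (hp : 1 ≤ p) (x : Fin d → ℝ) :
    pNorm p x ^ p = ∑ i, |x i| ^ p := by
  unfold pNorm
  rw [← Real.rpow_mul (Finset.sum_nonneg fun _ _ => Real.rpow_nonneg (abs_nonneg _) _),
    one_div_mul_cancel (by linarith), Real.rpow_one]

lemma eq_zero_of_pNorm_eq_zero {p : ℝ} (hp : 1 ≤ p) {x : Fin d → ℝ}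
    (hx : pNorm p x = 0) : x = 0 := by
  ext i
  have := abs_le_pNorm hp x i
  rw [hx] at this
  simpa using this

lemma dot_dualVec {p : ℝ} (hp : 1 ≤ p) (x : Fin d → ℝ) :
    dot x (dualVec p x) = pNorm p x := by
  rcases (pNorm_nonneg p x).eq_or_lt with h0 | h0
  · have := eq_zero_of_pNorm_eq_zero hp h0.symm
    rw [← h0, this]; simp [dot]
  have h1 : ∀ i, x i * dualVec p x i = |x i| ^ p / pNorm p x ^ (p - 1) := fun i => by
    unfold dualVec
    rcases eq_or_ne (x i) 0 with hi | hi
    · rw [hi, abs_zero, Real.zero_rpow (x := p) (by linarith)]; simp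
    · have h2 : x i * Real.sign (x i) = |x i| := by
        rcases hi.lt_or_gt with h | h
        · rw [Real.sign_of_neg h, abs_of_neg h]; ring
        · rw [Real.sign_of_pos h, abs_of_pos h]; ring
      rw [mul_div_assoc', ← mul_assoc, h2, Real.rpow_sub_one (abs_ne_zero.mpr hi)]
      field_simp
  unfold dot
  simp_rw [h1]
  rw [← Finset.sum_div, ← pNorm_rpow hp, Real.rpow_sub_one h0.ne']
  have : pNorm p x ^ p ≠ 0 := (Real.rpow_pos_of_pos h0 _).ne'
  field_simp

lemma abs_dualVec_le (p : ℝ) (x : Fin d → ℝ) (i : Fin d) :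
    |dualVec p x i| ≤ |x i| ^ (p - 1) / pNorm p x ^ (p - 1) := by
  unfold dualVec
  rw [abs_div, abs_mul, abs_of_nonneg (Real.rpow_nonneg (pNorm_nonneg _ _) _),
    abs_of_nonneg (Real.rpow_nonneg (abs_nonneg (x i)) _)]
  refine div_le_div_of_nonneg_right ?_ (Real.rpow_nonneg (pNorm_nonneg _ _) _)
  refine mul_le_of_le_one_left (Real.rpow_nonneg (abs_nonneg _) _) ?_
  rcases Real.sign_apply_eq (x i) with h | h | h <;> simp [h]

lemma pNorm_dualVec_le {p q : ℝ} (hpq : p.HolderConjugate q) (x : Fin d → ℝ) :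
    pNorm q (dualVec p x) ≤ 1 := by
  have hp : 1 ≤ p := hpq.lt.le
  have hq : 0 < q := hpq.symm.pos
  unfold pNorm
  refine Real.rpow_le_one (Finset.sum_nonneg fun _ _ => Real.rpow_nonneg (abs_nonneg _) _) ?_
    (by positivity)
  have h1 : ∀ i, |dualVec p x i| ^ q ≤ |x i| ^ p / pNorm p x ^ p := fun i => by
    refine (Real.rpow_le_rpow (abs_nonneg _) (abs_dualVec_le p x i) hq.le).trans_eq ?_
    rw [Real.div_rpow (Real.rpow_nonneg (abs_nonneg _) _) (Real.rpow_nonneg (pNorm_nonneg _ _) _),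
      ← Real.rpow_mul (abs_nonneg _), ← Real.rpow_mul (pNorm_nonneg _ _), hpq.sub_one_mul_conj]
  refine (Finset.sum_le_sum fun i _ => h1 i).trans ?_
  rw [← Finset.sum_div, ← pNorm_rpow hp]
  exact div_self_le_one _

lemma dot_le_pNorm_mul_pNorm {p q : ℝ} (hpq : p.HolderConjugate q) (x y : Fin d → ℝ) :
    dot x y ≤ pNorm p x * pNorm q y :=
  Real.inner_le_Lp_mul_Lq Finset.univ x y hpq

lemma holderConjugate_div {p : ℝ} (hp : 1 < p) : p.HolderConjugate (p / (p - 1)) :=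
  Real.HolderConjugate.conjExponent hp

lemma dot_le_qNorm_mul_pNorm {p : ℝ} (hp : 1 ≤ p) (x y : Fin d → ℝ) :
    dot x y ≤ qNorm p y * pNorm p x := by
  unfold qNorm
  split_ifs with h
  · subst h
    unfold dot pNorm
    simp only [Real.rpow_one, one_div, inv_one, Finset.mul_sum]
    refine Finset.sum_le_sum fun i _ => ?_
    calc x i * y i ≤ |x i * y i| := le_abs_self _
      _ = |y i| * |x i| := by rw [abs_mul, mul_comm]
      _ ≤ _ := mul_le_mul_of_nonneg_right
        (le_ciSup (f := fun i => |y i|) (Set.finite_range _).bddAbove i) (abs_nonneg _)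
  · rw [mul_comm]
    exact dot_le_pNorm_mul_pNorm (holderConjugate_div (lt_of_le_of_ne hp (Ne.symm h))) x y

lemma dot_le_of_qNorm_le {p c : ℝ} (hp : 1 ≤ p) {y : Fin d → ℝ} (hy : qNorm p y ≤ c)
    (x : Fin d → ℝ) : dot x y ≤ c * pNorm p x :=
  (dot_le_qNorm_mul_pNorm hp x y).trans (mul_le_mul_of_nonneg_right hy (pNorm_nonneg _ _))

lemma dot_dualVec_le {p : ℝ} (hp : 1 ≤ p) (x y : Fin d → ℝ) :
    dot x (dualVec p y) ≤ pNorm p x := by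
  rw [← one_mul (pNorm p x)]
  refine dot_le_of_qNorm_le hp ?_ x
  unfold qNorm
  split_ifs with h
  · subst h
    refine Real.iSup_le (fun i => (abs_dualVec_le 1 y i).trans ?_) zero_le_one
    simp
  · exact pNorm_dualVec_le (holderConjugate_div (lt_of_le_of_ne hp (Ne.symm h))) y

lemma abs_le_of_forall_dot_le {p c : ℝ} (hp : 1 ≤ p) {y : Fin d → ℝ}
    (h : ∀ x, dot x y ≤ c * pNorm p x) (i : Fin d) : |y i| ≤ c := by
  have h1 := h (Pi.single i 1)
  have h2 := h (Pi.single i (-1))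
  rw [dot_single, pNorm_single hp] at h1 h2
  norm_num at h1 h2
  exact abs_le.mpr ⟨by linarith, h1⟩

lemma qNorm_le_of_forall_dot_le {p c : ℝ} (hp : 1 ≤ p) (hc : 0 ≤ c) {y : Fin d → ℝ}
    (h : ∀ x, dot x y ≤ c * pNorm p x) : qNorm p y ≤ c := by
  unfold qNorm
  split_ifs with h1
  · exact Real.iSup_le (abs_le_of_forall_dot_le hp h) hc
  · have hpq := holderConjugate_div (lt_of_le_of_ne hp (Ne.symm h1))
    have h2 := h (dualVec (p / (p - 1)) y)
    have h3 : dot (dualVec (p / (p - 1)) y) y = pNorm (p / (p - 1)) y := by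
      rw [← dot_dualVec hpq.symm.lt.le y]
      exact Finset.sum_congr rfl fun i _ => mul_comm _ _
    rw [h3] at h2
    exact h2.trans (mul_le_of_le_one_right hc (pNorm_dualVec_le hpq.symm y))

lemma measurable_dualVec {p : ℝ} (hp : 1 ≤ p) :
    Measurable (dualVec p : (Fin d → ℝ) → Fin d → ℝ) := by
  have h := (continuous_pNorm (d := d) hp).measurable
  have hs : Measurable Real.sign := by
    unfold Real.sign
    exact Measurable.ite measurableSet_Iio measurable_const
      (Measurable.ite measurableSet_Ioi measurable_const measurable_const)
  refine measurable_pi_iff.mpr fun i => ?_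
  unfold dualVec
  exact ((hs.comp (measurable_pi_apply i)).mul ((measurable_pi_apply i).abs.pow_const _)).div
    (h.pow_const _)

lemma dot_sub_right (x y z : Fin d → ℝ) : dot x (y - z) = dot x y - dot x z := by
  simp [dot, mul_sub]

lemma dot_smul_right (c : ℝ) (x y : Fin d → ℝ) : dot x (c • y) = c * dot x y := by
  simp only [dot, Finset.mul_sum, Pi.smul_apply, smul_eq_mul]
  exact Finset.sum_congr rfl fun i _ => by ring

lemma continuous_dot : Continuous fun x : (Fin d → ℝ) × (Fin d → ℝ) => dot x.1 x.2 := by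
  unfold dot; fun_prop


/-- The one-period cone condition: bounded `G`-measurable positions in the increment `X` have
expected gain at most `ε` times their expected `p`-norm. -/
def GainBound (μ : Measure Ω) (G : MeasurableSpace Ω) (X : Ω → Fin d → ℝ) (p ε : ℝ) : Prop :=
  ∀ h : Ω → Fin d → ℝ, StronglyMeasurable[G] h → (∃ C, ∀ ω, pNorm p (h ω) ≤ C) →
    ∫ ω, dot (h ω) (X ω) ∂μ ≤ ε * ∫ ω, pNorm p (h ω) ∂μ

lemma stronglyMeasurable_dot {Ω : Type*} {G : MeasurableSpace Ω} {h X : Ω → Fin d → ℝ}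
    (hh : StronglyMeasurable[G] h) (hX : StronglyMeasurable[G] X) :
    StronglyMeasurable[G] fun ω => dot (h ω) (X ω) :=
  continuous_dot.comp_stronglyMeasurable (hh.prodMk hX)

lemma stronglyMeasurable_pNorm {Ω : Type*} {G : MeasurableSpace Ω} {h : Ω → Fin d → ℝ}
    {p : ℝ} (hp : 1 ≤ p) (hh : StronglyMeasurable[G] h) :
    StronglyMeasurable[G] fun ω => pNorm p (h ω) :=
  (continuous_pNorm hp).comp_stronglyMeasurable hh

lemma stronglyMeasurable_apply {Ω : Type*} {G : MeasurableSpace Ω} {h : Ω → Fin d → ℝ}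
    (hh : StronglyMeasurable[G] h) (i : Fin d) : StronglyMeasurable[G] fun ω => h ω i :=
  (continuous_apply i).comp_stronglyMeasurable hh

lemma integrable_pNorm {μ : Measure Ω} [IsFiniteMeasure μ] {p C : ℝ} (hp : 1 ≤ p)
    {h : Ω → Fin d → ℝ} (hh : StronglyMeasurable h) (hC : ∀ ω, pNorm p (h ω) ≤ C) :
    Integrable (fun ω => pNorm p (h ω)) μ :=
  Integrable.of_bound (stronglyMeasurable_pNorm hp hh).aestronglyMeasurable C
    (.of_forall fun ω => by rw [Real.norm_of_nonneg (pNorm_nonneg _ _)]; exact hC ω)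

lemma integrable_apply_mul {μ : Measure Ω} {p C : ℝ} (hp : 1 ≤ p)
    {h X : Ω → Fin d → ℝ} (hh : StronglyMeasurable h) (hC : ∀ ω, pNorm p (h ω) ≤ C)
    (hX : ∀ i, Integrable (fun ω => X ω i) μ) (i : Fin d) :
    Integrable (fun ω => h ω i * X ω i) μ :=
  (hX i).bdd_mul (stronglyMeasurable_apply hh i).aestronglyMeasurable
    (.of_forall fun ω => (abs_le_pNorm hp (h ω) i).trans (hC ω))

lemma integrable_dot {μ : Measure Ω} {p C : ℝ} (hp : 1 ≤ p)
    {h X : Ω → Fin d → ℝ} (hh : StronglyMeasurable h) (hC : ∀ ω, pNorm p (h ω) ≤ C)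
    (hX : ∀ i, Integrable (fun ω => X ω i) μ) :
    Integrable (fun ω => dot (h ω) (X ω)) μ :=
  integrable_finsetSum _ fun i _ => integrable_apply_mul hp hh hC hX i

lemma integral_dot_condExp {Ω : Type*} {G mΩ : MeasurableSpace Ω} (hG : G ≤ mΩ) {μ : Measure Ω}
    [IsFiniteMeasure μ] {p C : ℝ} (hp : 1 ≤ p) {h X : Ω → Fin d → ℝ}
    (hh : StronglyMeasurable[G] h) (hC : ∀ ω, pNorm p (h ω) ≤ C) (hX : Integrable X μ) :
    ∫ ω, dot (h ω) ((μ[X | G]) ω) ∂μ = ∫ ω, dot (h ω) (X ω) ∂μ := by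
  have hXi : ∀ i, Integrable (fun ω => X ω i) μ := fun i => hX.eval i
  have hYi : ∀ i, Integrable (fun ω => (μ[X | G]) ω i) μ :=
    fun i => (integrable_condExp (m := G) (μ := μ) (f := X)).eval i
  unfold dot
  rw [integral_finsetSum _ fun i _ => integrable_apply_mul hp (hh.mono hG) hC hXi i,
    integral_finsetSum _ fun i _ => integrable_apply_mul hp (hh.mono hG) hC hYi i]
  refine Finset.sum_congr rfl fun i _ => ?_
  have h1 : (fun ω => (μ[X | G]) ω i) =ᵐ[μ] μ[fun ω => X ω i | G] :=
    (ContinuousLinearMap.proj (R := ℝ) (φ := fun _ : Fin d => ℝ) i).comp_condExp_comm hX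
  have h2 := condExp_mul_of_stronglyMeasurable_left (stronglyMeasurable_apply hh i)
    (integrable_apply_mul hp (hh.mono hG) hC hXi i) (hXi i)
  rw [← integral_condExp hG (f := fun ω => h ω i * X ω i)]
  refine integral_congr_ae ?_
  filter_upwards [h1, h2] with ω h3 h4
  rw [h3]
  exact h4.symm

lemma GainBound.of_qNorm_le {Ω : Type*} {G mΩ : MeasurableSpace Ω} (hG : G ≤ mΩ) {μ : Measure Ω}
    [IsFiniteMeasure μ] {p ε : ℝ} (hp : 1 ≤ p) {X Y : Ω → Fin d → ℝ}
    (hX : Integrable X μ) (hY : Integrable Y μ)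
    (h : ∀ᵐ ω ∂μ, qNorm p ((μ[X | G]) ω - Y ω) ≤ ε) :
    GainBound μ G (fun ω => X ω - Y ω) p ε := by
  rintro g hg ⟨C, hC⟩
  simp_rw [dot_sub_right]
  have hXi : Integrable (fun ω => dot (g ω) (X ω)) μ :=
    integrable_dot hp (hg.mono hG) hC fun i => hX.eval i
  have hZi : Integrable (fun ω => dot (g ω) ((μ[X | G]) ω)) μ :=
    integrable_dot hp (hg.mono hG) hC
      fun i => (integrable_condExp (m := G) (μ := μ) (f := X)).eval i
  have hYi : Integrable (fun ω => dot (g ω) (Y ω)) μ :=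
    integrable_dot hp (hg.mono hG) hC fun i => hY.eval i
  rw [integral_sub hXi hYi, ← integral_dot_condExp hG hp hg hC hX, ← integral_sub hZi hYi,
    ← integral_const_mul]
  refine integral_mono_ae (hZi.sub hYi) ((integrable_pNorm hp (hg.mono hG) hC).const_mul ε) ?_
  filter_upwards [h] with ω hω
  rw [← dot_sub_right]
  exact dot_le_of_qNorm_le hp hω _

lemma GainBound.qNorm_le {Ω : Type*} {G mΩ : MeasurableSpace Ω} (hG : G ≤ mΩ) {μ : Measure Ω}
    [IsFiniteMeasure μ] {p ε : ℝ} (hp : 1 ≤ p) (hε : 0 ≤ ε) {X Y : Ω → Fin d → ℝ}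
    (hX : Integrable X μ) (hY : Integrable Y μ) (hYm : StronglyMeasurable[G] Y)
    (h : GainBound μ G (fun ω => X ω - Y ω) p ε) :
    ∀ᵐ ω ∂μ, qNorm p ((μ[X | G]) ω - Y ω) ≤ ε := by
  set W : Ω → Fin d → ℝ := fun ω => (μ[X | G]) ω - Y ω with hW
  have hWm : StronglyMeasurable[G] W := stronglyMeasurable_condExp.sub hYm
  have hWi : Integrable W μ := integrable_condExp.sub hY
  have key : ∀ g : Fin d → ℝ, ∀ᵐ ω ∂μ, dot g (W ω) ≤ ε * pNorm p g := by
    intro g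
    set s := {ω | ε * pNorm p g < dot g (W ω)} with hs_def
    have hs : MeasurableSet[G] s :=
      (stronglyMeasurable_const).measurableSet_lt
        (stronglyMeasurable_dot (stronglyMeasurable_const (b := g)) hWm)
    have hgm : StronglyMeasurable[G] (s.indicator fun _ => g) :=
      (stronglyMeasurable_const).indicator hs
    have hgC : ∀ ω, pNorm p (s.indicator (fun _ => g) ω) ≤ pNorm p g := fun ω => by
      by_cases hω : ω ∈ s
      · simp [hω]
      · simp [hω, pNorm_zero hp, pNorm_nonneg]
    have h1 := h _ hgm ⟨_, hgC⟩
    have e1 : ∫ ω, dot (s.indicator (fun _ => g) ω) (X ω - Y ω) ∂μ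
        = ∫ ω, dot (s.indicator (fun _ => g) ω) (W ω) ∂μ := by
      have hXi : Integrable (fun ω => dot (s.indicator (fun _ => g) ω) (X ω)) μ :=
        integrable_dot hp (hgm.mono hG) hgC fun i => hX.eval i
      have hZi : Integrable (fun ω => dot (s.indicator (fun _ => g) ω) ((μ[X | G]) ω)) μ :=
        integrable_dot hp (hgm.mono hG) hgC
          fun i => (integrable_condExp (m := G) (μ := μ) (f := X)).eval i
      have hYi : Integrable (fun ω => dot (s.indicator (fun _ => g) ω) (Y ω)) μ :=
        integrable_dot hp (hgm.mono hG) hgC fun i => hY.eval i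
      simp_rw [hW, dot_sub_right]
      rw [integral_sub hXi hYi, ← integral_dot_condExp hG hp hgm hgC hX, ← integral_sub hZi hYi]
    rw [e1, ← integral_const_mul, ← sub_nonneg, ← integral_sub
      ((integrable_pNorm hp (hgm.mono hG) hgC).const_mul ε)
      (integrable_dot hp (hgm.mono hG) hgC fun i => hWi.eval i)] at h1
    set f : Ω → ℝ := fun ω => ε * pNorm p (s.indicator (fun _ => g) ω)
      - dot (s.indicator (fun _ => g) ω) (W ω) with hf
    have hfi : Integrable f μ := ((integrable_pNorm hp (hgm.mono hG) hgC).const_mul ε).sub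
      (integrable_dot hp (hgm.mono hG) hgC fun i => hWi.eval i)
    have hf0 : 0 ≤ -f := fun ω => by
      by_cases hω : ω ∈ s
      · have : ε * pNorm p g < dot g (W ω) := hω
        simp [hf, hω]; linarith
      · simp [hf, hω, pNorm_zero hp, dot]
    have h2 : ∫ ω, (-f) ω ∂μ = 0 := by
      refine le_antisymm ?_ (integral_nonneg hf0)
      simp only [Pi.neg_apply, integral_neg]
      linarith
    rw [integral_eq_zero_iff_of_nonneg hf0 hfi.neg] at h2
    filter_upwards [h2] with ω hω
    by_contra hlt
    have hs' : ω ∈ s := not_le.mp hlt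
    simp [hf, hs'] at hω
    linarith
  obtain ⟨D, hDc, hDd⟩ := TopologicalSpace.exists_countable_dense (Fin d → ℝ)
  have key2 : ∀ᵐ ω ∂μ, ∀ g ∈ D, dot g (W ω) ≤ ε * pNorm p g :=
    (ae_ball_iff hDc).mpr fun g _ => key g
  filter_upwards [key2] with ω hω
  refine qNorm_le_of_forall_dot_le hp hε fun g => ?_
  have hcl : IsClosed {g : Fin d → ℝ | dot g (W ω) ≤ ε * pNorm p g} :=
    isClosed_le (continuous_dot.comp (by fun_prop : Continuous fun g : Fin d → ℝ => (g, W ω)))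
      ((continuous_pNorm hp).const_mul ε)
  exact hcl.closure_subset_iff.mpr hω (hDd g)

/-- A position whose penalised gain is nonnegative on a `G`-measurable set has zero penalised
gain there. -/
lemma GainBound.ae_eq_zero {Ω : Type*} {G mΩ : MeasurableSpace Ω} (hG : G ≤ mΩ) {μ : Measure Ω}
    [IsFiniteMeasure μ] {p ε : ℝ} (hp : 1 ≤ p) {X h : Ω → Fin d → ℝ}
    (hX : Integrable X μ) (hb : GainBound μ G X p ε) (hh : StronglyMeasurable[G] h)
    {s : Set Ω} (hs : MeasurableSet[G] s)
    (hpos : ∀ᵐ ω ∂μ, ω ∈ s → 0 ≤ dot (h ω) (X ω) - ε * pNorm p (h ω)) :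
    ∀ᵐ ω ∂μ, ω ∈ s → dot (h ω) (X ω) - ε * pNorm p (h ω) = 0 := by
  have key : ∀ n : ℕ, ∀ᵐ ω ∂μ, ω ∈ s → pNorm p (h ω) ≤ n →
      dot (h ω) (X ω) - ε * pNorm p (h ω) = 0 := by
    intro n
    set A := s ∩ {ω | pNorm p (h ω) ≤ n} with hA_def
    have hA : MeasurableSet[G] A :=
      hs.inter ((stronglyMeasurable_pNorm hp hh).measurableSet_le stronglyMeasurable_const)
    have hgm : StronglyMeasurable[G] (A.indicator h) := hh.indicator hA
    have hgC : ∀ ω, pNorm p (A.indicator h ω) ≤ n := fun ω => by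
      by_cases hω : ω ∈ A
      · simpa [hω] using hω.2
      · simp [hω, pNorm_zero hp]
    have h1 := hb _ hgm ⟨_, hgC⟩
    have hi1 := (integrable_pNorm (μ := μ) hp (hgm.mono hG) hgC).const_mul ε
    have hi2 := integrable_dot hp (hgm.mono hG) hgC fun i => hX.eval i
    set f : Ω → ℝ := fun ω => dot (A.indicator h ω) (X ω) - ε * pNorm p (A.indicator h ω) with hf
    have hf0 : 0 ≤ᵐ[μ] f := by
      filter_upwards [hpos] with ω hω
      by_cases hωA : ω ∈ A
      · simpa [hf, hωA] using hω hωA.1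
      · simp [hf, hωA, pNorm_zero hp, dot]
    have h2 : ∫ ω, f ω ∂μ = 0 := by
      refine le_antisymm ?_ (integral_nonneg_of_ae hf0)
      rw [hf, integral_sub hi2 hi1, integral_const_mul]
      linarith
    rw [integral_eq_zero_iff_of_nonneg_ae hf0 (hi2.sub hi1)] at h2
    filter_upwards [h2] with ω hω h3 h4
    have : ω ∈ A := ⟨h3, h4⟩
    simpa [hf, this] using hω
  filter_upwards [ae_all_iff.mpr key] with ω hω hs
  obtain ⟨n, hn⟩ := exists_nat_ge (pNorm p (h ω))
  exact hω n hs hn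

lemma GainBound.mono {Ω : Type*} {G mΩ : MeasurableSpace Ω} {μ : Measure Ω}
    {X : Ω → Fin d → ℝ} {p ε ε' : ℝ} (h : GainBound μ G X p ε) (hε : ε ≤ ε') :
    GainBound μ G X p ε' := fun g hg hC =>
  (h g hg hC).trans (mul_le_mul_of_nonneg_right hε (integral_nonneg fun _ => pNorm_nonneg _ _))

lemma gain_succ {Ω : Type*} (S H : ℕ → Ω → Fin d → ℝ) (n : ℕ) (ω : Ω) :
    gain S H (n + 1) ω = gain S H n ω + dot (H (n + 1) ω) (S (n + 1) ω - S n ω) := by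
  simp [gain, Finset.sum_Icc_succ_top]

lemma stratNorm_succ {Ω : Type*} (p : ℝ) (H : ℕ → Ω → Fin d → ℝ) (n : ℕ) (ω : Ω) :
    stratNorm p H (n + 1) ω = stratNorm p H n ω + pNorm p (H (n + 1) ω) := by
  simp [stratNorm, Finset.sum_Icc_succ_top]

lemma stronglyMeasurable_gain_sub {ℱ : Filtration ℕ mΩ} {S H : ℕ → Ω → Fin d → ℝ}
    (hS : Adapted ℱ S) (hH : IsStrategy ℱ H) {p : ℝ} (hp : 1 ≤ p) (ε : ℝ) (n : ℕ) :
    StronglyMeasurable[ℱ n] fun ω => gain S H n ω - ε * stratNorm p H n ω := by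
  have h1 : ∀ t ∈ Finset.Icc 1 n, StronglyMeasurable[ℱ n] (H t) := fun t ht =>
    (hH t (Finset.mem_Icc.mp ht).1).mono
      (ℱ.mono ((Nat.sub_le t 1).trans (Finset.mem_Icc.mp ht).2))
  have h2 : ∀ t ≤ n, StronglyMeasurable[ℱ n] (S t) := fun t ht =>
    ((hS t).mono (ℱ.mono ht) le_rfl).stronglyMeasurable
  refine StronglyMeasurable.sub ?_ (StronglyMeasurable.const_mul ?_ ε)
  · refine Finset.stronglyMeasurable_fun_sum _ fun t ht => stronglyMeasurable_dot (h1 t ht) ?_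
    have := (Finset.mem_Icc.mp ht).2
    exact (h2 t this).sub (h2 (t - 1) (by omega))
  · exact Finset.stronglyMeasurable_fun_sum _ fun t ht => stronglyMeasurable_pNorm hp (h1 t ht)

lemma ae_gain_sub_eq_zero {ℱ : Filtration ℕ mΩ} {S H : ℕ → Ω → Fin d → ℝ}
    (hS : Adapted ℱ S) (hH : IsStrategy ℱ H) {p ε : ℝ} (hp : 1 ≤ p) {Q : Measure Ω}
    [IsFiniteMeasure Q] {T : ℕ} (hSi : ∀ t ≤ T, Integrable (S t) Q)
    (hb : ∀ t, 1 ≤ t → t ≤ T → GainBound Q (ℱ (t - 1)) (fun ω => S t ω - S (t - 1) ω) p ε)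
    (hpos : ∀ᵐ ω ∂Q, 0 ≤ gain S H T ω - ε * stratNorm p H T ω) :
    ∀ᵐ ω ∂Q, gain S H T ω - ε * stratNorm p H T ω = 0 := by
  induction T with
  | zero => simp [gain, stratNorm]
  | succ n ih =>
    have hbn : GainBound Q (ℱ n) (fun ω => S (n + 1) ω - S n ω) p ε := hb (n + 1) (by omega) le_rfl
    have hHn : StronglyMeasurable[ℱ n] (H (n + 1)) := hH (n + 1) (by omega)
    have hXi : Integrable (fun ω => S (n + 1) ω - S n ω) Q :=
      (hSi (n + 1) le_rfl).sub (hSi n (by omega))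
    have hV := stronglyMeasurable_gain_sub hS hH hp ε n
    have h1 := hbn.ae_eq_zero (ℱ.le n) hp hXi hHn
      (hV.measurableSet_lt (stronglyMeasurable_const (b := (0 : ℝ)))) (by
        filter_upwards [hpos] with ω h0 hneg
        rw [gain_succ, stratNorm_succ] at h0
        have hneg : gain S H n ω - ε * stratNorm p H n ω < 0 := hneg
        linarith)
    have h2 := ih (fun t ht => hSi t (by omega)) (fun t h h' => hb t h (by omega)) (by
      filter_upwards [hpos, h1] with ω h0 h1
      by_contra hneg
      have := h1 (not_le.mp hneg)
      rw [gain_succ, stratNorm_succ] at h0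
      linarith)
    have h3 := hbn.ae_eq_zero (ℱ.le n) hp hXi hHn MeasurableSet.univ (by
      filter_upwards [hpos, h2] with ω h0 h2 _
      rw [gain_succ, stratNorm_succ] at h0
      linarith)
    filter_upwards [h2, h3] with ω h2 h3
    have := h3 trivial
    rw [gain_succ, stratNorm_succ]
    linarith

lemma IsEpsMartMeasure.not_exists_isStrictArb {P : Measure Ω} {ℱ : Filtration ℕ mΩ}
    {S : ℕ → Ω → Fin d → ℝ} (hS : Adapted ℱ S) {T : ℕ} {p ε ε' : ℝ} (hp : 1 ≤ p)
    (hε : ε ≤ ε') {Q : Measure Ω} (hQ : IsEpsMartMeasure P ℱ S T p ε Q) :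
    ¬ ∃ H, IsStrictArb P ℱ S T p ε' H := by
  rintro ⟨H, hH, h0, hlt⟩
  obtain ⟨hprob, hQP, hPQ, hST, hcond⟩ := hQ
  have hSi : ∀ t ≤ T, Integrable (S t) Q := by
    intro t ht
    rcases ht.eq_or_lt with rfl | ht
    · exact hST
    have hSm : StronglyMeasurable (S t) := ((hS t).mono (ℱ.le t) le_rfl).stronglyMeasurable
    have h1 : Integrable (fun ω => (Q[S (t + 1) | ℱ t]) ω - S t ω) Q := by
      refine Integrable.of_bound
        ((stronglyMeasurable_condExp.mono (ℱ.le t)).sub hSm).aestronglyMeasurable |ε| ?_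
      filter_upwards [hcond (t + 1) (by omega) ht] with ω hω
      exact (pi_norm_le_iff_of_nonneg (abs_nonneg _)).mpr fun i =>
        (abs_le_of_forall_dot_le hp (dot_le_of_qNorm_le hp hω) i).trans (le_abs_self _)
    have h2 := (integrable_condExp (m := ℱ t) (μ := Q) (f := S (t + 1))).sub h1
    refine h2.congr (.of_forall fun ω => ?_)
    simp
  have h1 := ae_gain_sub_eq_zero hS hH hp (T := T) (ε := ε') hSi (fun t h1 h2 =>
    (GainBound.of_qNorm_le (ℱ.le _) hp (hSi t h2) (hSi (t - 1) (by omega)) (hcond t h1 h2)).mono hε)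
    (hQP.ae_le h0)
  refine hlt.ne' (measure_eq_zero_iff_ae_notMem.mpr ?_)
  filter_upwards [hPQ.ae_le h1] with ω hω
  simp [hω]

lemma pNorm_le_sum_abs {p : ℝ} (hp : 1 ≤ p) (x : Fin d → ℝ) : pNorm p x ≤ ∑ i, |x i| := by
  rw [← dot_dualVec hp x]
  refine Finset.sum_le_sum fun i _ => ?_
  have h1 : |dualVec p x i| ≤ 1 :=
    abs_le_of_forall_dot_le hp (fun g => by simpa using dot_dualVec_le hp g x) i
  calc x i * dualVec p x i ≤ |x i * dualVec p x i| := le_abs_self _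
    _ = |x i| * |dualVec p x i| := abs_mul _ _
    _ ≤ |x i| := mul_le_of_le_one_right (abs_nonneg _) h1

/-- `F`-measurable weights with values in some interval `[1, C]`. -/
def IsWeight {Ω : Type*} (F : MeasurableSpace Ω) (Z : Ω → ℝ) : Prop :=
  Measurable[F] Z ∧ ∃ C, ∀ ω, 1 ≤ Z ω ∧ Z ω ≤ C

lemma IsWeight.convexCombo {Ω : Type*} {F : MeasurableSpace Ω} {Z Z' : Ω → ℝ} (hZ : IsWeight F Z)
    (hZ' : IsWeight F Z') {a b : ℝ} (ha : 0 ≤ a) (hb : 0 ≤ b) (hab : a + b = 1) :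
    IsWeight F fun ω => a * Z ω + b * Z' ω := by
  obtain ⟨hm, C, hC⟩ := hZ
  obtain ⟨hm', C', hC'⟩ := hZ'
  refine ⟨(hm.const_mul a).add (hm'.const_mul b), a * C + b * C', fun ω => ⟨?_, ?_⟩⟩
  · nlinarith [(hC ω).1, (hC' ω).1]
  · nlinarith [(hC ω).2, (hC' ω).2]

lemma IsWeight.integrable_mul {Ω : Type*} {F mΩ : MeasurableSpace Ω} (hF : F ≤ mΩ)
    {μ : Measure Ω} {Z f : Ω → ℝ} (hZ : IsWeight F Z) (hf : Integrable f μ) :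
    Integrable (fun ω => Z ω * f ω) μ := by
  obtain ⟨hm, C, hC⟩ := hZ
  refine hf.bdd_mul (c := C) (hm.mono hF le_rfl).aestronglyMeasurable (.of_forall fun ω => ?_)
  rw [Real.norm_of_nonneg (by linarith [(hC ω).1])]
  exact (hC ω).2

section OnePeriod

variable {Ω : Type*} {G F mΩ : MeasurableSpace Ω} {μ : Measure Ω} {p ε : ℝ} {X : Ω → Fin d → ℝ}

lemma integrable_dot_of_memLp {h X : Ω → Fin d → ℝ} (hh : ∀ i, MemLp (fun ω => h ω i) 2 μ)
    (hX : ∀ i, MemLp (fun ω => X ω i) 2 μ) : Integrable (fun ω => dot (h ω) (X ω)) μ :=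
  integrable_finsetSum _ fun i _ => (hh i).integrable_mul (hX i)

lemma integrable_pNorm_of_memLp [IsFiniteMeasure μ] (hp : 1 ≤ p) {h : Ω → Fin d → ℝ}
    (hh : ∀ i, MemLp (fun ω => h ω i) 2 μ) : Integrable (fun ω => pNorm p (h ω)) μ := by
  have hm : AEStronglyMeasurable h μ :=
    (aemeasurable_pi_lambda _ fun i =>
      (hh i).aestronglyMeasurable.aemeasurable).aestronglyMeasurable
  refine (integrable_finsetSum Finset.univ fun i _ => ((hh i).integrable one_le_two).abs).mono'
    ((continuous_pNorm hp).comp_aestronglyMeasurable hm) (.of_forall fun ω => ?_)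
  rw [Real.norm_of_nonneg (pNorm_nonneg _ _)]
  exact pNorm_le_sum_abs hp _

/-- Elements `a ∈ L²(G)` whose pairing dominates the penalised gain functional of some weight. -/
def dominators (G F : MeasurableSpace Ω) [mΩ : MeasurableSpace Ω] (μ : Measure Ω)
    (X : Ω → Fin d → ℝ) (p ε : ℝ) :
    Set (Lp (EuclideanSpace ℝ (Fin d)) 2 μ) :=
  {a | AEStronglyMeasurable[G] a μ ∧ ∃ Z, IsWeight F Z ∧
    ∀ h : Lp (EuclideanSpace ℝ (Fin d)) 2 μ, AEStronglyMeasurable[G] h μ →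
      ∫ ω, Z ω * (dot (h ω).ofLp (X ω) - ε * pNorm p (h ω).ofLp) ∂μ ≤ inner ℝ h a}

lemma memLp_coord (h : Lp (EuclideanSpace ℝ (Fin d)) 2 μ) (i : Fin d) :
    MemLp (fun ω => (h ω).ofLp i) 2 μ :=
  MemLp.eval_piLp (Lp.memLp h) i

lemma inner_eq_integral_dot (h a : Lp (EuclideanSpace ℝ (Fin d)) 2 μ) :
    inner ℝ h a = ∫ ω, dot (h ω).ofLp (a ω).ofLp ∂μ := by
  rw [L2.inner_def]
  refine integral_congr_ae (.of_forall fun ω => ?_)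
  simp only [PiLp.inner_apply, dot, RCLike.inner_apply, conj_trivial]
  exact Finset.sum_congr rfl fun i _ => mul_comm _ _

lemma integrable_penalised [IsFiniteMeasure μ] (hp : 1 ≤ p)
    (hX : ∀ i, MemLp (fun ω => X ω i) 2 μ) (h : Lp (EuclideanSpace ℝ (Fin d)) 2 μ) :
    Integrable (fun ω => dot (h ω).ofLp (X ω) - ε * pNorm p (h ω).ofLp) μ :=
  (integrable_dot_of_memLp (memLp_coord h) hX).sub
    ((integrable_pNorm_of_memLp hp (memLp_coord h)).const_mul ε)

lemma convex_dominators [IsFiniteMeasure μ] (hF : F ≤ mΩ) (hp : 1 ≤ p)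
    (hX : ∀ i, MemLp (fun ω => X ω i) 2 μ) : Convex ℝ (dominators G F μ X p ε) := by
  rintro a ⟨ha, Z, hZ, hZa⟩ b ⟨hb, Z', hZ', hZb⟩ s t hs ht hst
  refine ⟨?_, _, hZ.convexCombo hZ' hs ht hst, fun h hh => ?_⟩
  · refine ((ha.const_smul s).add (hb.const_smul t)).congr ?_
    filter_upwards [Lp.coeFn_add (s • a) (t • b), Lp.coeFn_smul s a, Lp.coeFn_smul t b]
      with ω h1 h2 h3
    rw [h1, Pi.add_apply, Pi.add_apply, h2, h3]
  · have hi := integrable_penalised (ε := ε) hp hX h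
    have e : ∀ ω, (s * Z ω + t * Z' ω) * (dot (h ω).ofLp (X ω) - ε * pNorm p (h ω).ofLp)
        = s * (Z ω * (dot (h ω).ofLp (X ω) - ε * pNorm p (h ω).ofLp))
        + t * (Z' ω * (dot (h ω).ofLp (X ω) - ε * pNorm p (h ω).ofLp)) := fun ω => by ring
    simp_rw [e]
    rw [integral_add ((hZ.integrable_mul hF hi).const_mul s)
      ((hZ'.integrable_mul hF hi).const_mul t), integral_const_mul, integral_const_mul,
      inner_add_right, real_inner_smul_right, real_inner_smul_right]
    exact add_le_add (mul_le_mul_of_nonneg_left (hZa h hh) hs)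
      (mul_le_mul_of_nonneg_left (hZb h hh) ht)

lemma exists_mem_dominators_inner_eq [IsFiniteMeasure μ] (hG : G ≤ mΩ) (hF : F ≤ mΩ) (hp : 1 ≤ p)
    (hε : 0 ≤ ε) (hX : ∀ i, MemLp (fun ω => X ω i) 2 μ) {Z : Ω → ℝ} (hZ : IsWeight F Z)
    {u : Lp (EuclideanSpace ℝ (Fin d)) 2 μ} (hu : AEStronglyMeasurable[G] u μ) :
    ∃ a ∈ dominators G F μ X p ε,
      inner ℝ u a = ∫ ω, Z ω * (dot (u ω).ofLp (X ω) - ε * pNorm p (u ω).ofLp) ∂μ := by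
  have hZm : AEStronglyMeasurable Z μ := (hZ.1.mono hF le_rfl).aestronglyMeasurable
  set D : Ω → Fin d → ℝ := fun ω => dualVec p (u ω).ofLp with hD
  have hD1 : ∀ ω i, |D ω i| ≤ 1 := fun ω =>
    abs_le_of_forall_dot_le hp (fun g => by simpa using dot_dualVec_le hp g _)
  have hDm : AEMeasurable D μ := (measurable_dualVec hp).comp_aemeasurable
    (aemeasurable_pi_lambda _ fun i => (memLp_coord u i).aestronglyMeasurable.aemeasurable)
  have hDi : ∀ i, MemLp (fun ω => D ω i) 2 μ := fun i =>
    MemLp.of_bound ((measurable_pi_apply i).comp_aemeasurable hDm).aestronglyMeasurable 1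
      (.of_forall fun ω => hD1 ω i)
  have hW : MemLp (fun ω => WithLp.toLp 2 (Z ω • (X ω - ε • D ω)) : Ω → EuclideanSpace ℝ (Fin d))
      2 μ := by
    refine MemLp.of_eval_piLp fun i => ?_
    obtain ⟨C, hC⟩ := hZ.2
    have h1 : MemLp (fun ω => X ω i - ε * D ω i) 2 μ := (hX i).sub ((hDi i).const_mul ε)
    refine (h1.const_mul C).mono (hZm.mul h1.aestronglyMeasurable) (.of_forall fun ω => ?_)
    change ‖Z ω * (X ω i - ε * D ω i)‖ ≤ ‖C * (X ω i - ε * D ω i)‖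
    rw [norm_mul, norm_mul]
    refine mul_le_mul_of_nonneg_right ?_ (norm_nonneg _)
    rw [Real.norm_of_nonneg (by linarith [(hC ω).1]), Real.norm_of_nonneg
      (by linarith [(hC ω).1, (hC ω).2])]
    exact (hC ω).2
  have hin : ∀ h : Lp (EuclideanSpace ℝ (Fin d)) 2 μ, AEStronglyMeasurable[G] h μ →
      inner ℝ h (condExpL2 (EuclideanSpace ℝ (Fin d)) ℝ hG hW.toLp :
        Lp (EuclideanSpace ℝ (Fin d)) 2 μ)
      = ∫ ω, Z ω * (dot (h ω).ofLp (X ω) - ε * dot (h ω).ofLp (D ω)) ∂μ := fun h hh => by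
    rw [real_inner_comm, inner_condExpL2_eq_inner_fun hG _ _ hh, real_inner_comm,
      inner_eq_integral_dot]
    refine integral_congr_ae ?_
    filter_upwards [hW.coeFn_toLp] with ω hω
    rw [hω, WithLp.ofLp_toLp, dot_smul_right, dot_sub_right, dot_smul_right]
  refine ⟨_, ⟨lpMeas.aestronglyMeasurable (condExpL2 (EuclideanSpace ℝ (Fin d)) ℝ hG hW.toLp), Z,
    hZ, fun h hh => ?_⟩, ?_⟩
  · rw [hin h hh]
    refine integral_mono (hZ.integrable_mul hF (integrable_penalised hp hX h))
      (hZ.integrable_mul hF ((integrable_dot_of_memLp (memLp_coord h) hX).sub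
        ((integrable_dot_of_memLp (memLp_coord h) hDi).const_mul ε))) fun ω => ?_
    obtain ⟨C, hC⟩ := hZ.2
    refine mul_le_mul_of_nonneg_left ?_ (by linarith [(hC ω).1])
    exact sub_le_sub_left (mul_le_mul_of_nonneg_left (dot_dualVec_le hp _ _) hε) _
  · rw [hin u hu]
    simp_rw [hD, dot_dualVec hp]

lemma zero_mem_closure_dominators [IsFiniteMeasure μ] (hGF : G ≤ F) (hF : F ≤ mΩ) (hp : 1 ≤ p)
    (hε : 0 ≤ ε) (hXm : StronglyMeasurable[F] X) (hX : ∀ i, MemLp (fun ω => X ω i) 2 μ)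
    (hna : ∀ h : Ω → Fin d → ℝ, StronglyMeasurable[G] h →
      (∀ᵐ ω ∂μ, 0 ≤ dot (h ω) (X ω) - ε * pNorm p (h ω)) →
      ∀ᵐ ω ∂μ, dot (h ω) (X ω) - ε * pNorm p (h ω) = 0) :
    (0 : Lp (EuclideanSpace ℝ (Fin d)) 2 μ) ∈ closure (dominators G F μ X p ε) := by
  have hG := hGF.trans hF
  by_contra h0
  have hone : IsWeight F fun _ : Ω => (1 : ℝ) := ⟨measurable_const, 1, fun _ => ⟨le_rfl, le_rfl⟩⟩
  have hne : (closure (dominators G F μ X p ε)).Nonempty := by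
    obtain ⟨a, ha, -⟩ := exists_mem_dominators_inner_eq (u := 0) hG hF hp hε hX hone
      (aestronglyMeasurable_const.congr (Lp.coeFn_zero _ _ _).symm)
    exact ⟨a, subset_closure ha⟩
  have hconv := (convex_dominators (G := G) (ε := ε) hF hp hX).closure
  obtain ⟨v, hv, hmin⟩ :=
    exists_norm_eq_iInf_of_complete_convex hne isClosed_closure.isComplete hconv 0
  rw [norm_eq_iInf_iff_real_inner_le_zero hconv hv] at hmin
  have hvG : AEStronglyMeasurable[G] v μ :=
    (isClosed_aestronglyMeasurable hG).closure_subset_iff.mpr (fun a ha => ha.1) hv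
  have hc : 0 < ‖v‖ ^ 2 := by
    have : v ≠ 0 := fun h => h0 (h ▸ hv)
    positivity
  have hpos : ∀ Z, IsWeight F Z →
      ‖v‖ ^ 2 ≤ ∫ ω, Z ω * (dot (v ω).ofLp (X ω) - ε * pNorm p (v ω).ofLp) ∂μ := by
    intro Z hZ
    obtain ⟨a, ha, hva⟩ := exists_mem_dominators_inner_eq hG hF hp hε hX hZ hvG
    have := hmin a (subset_closure ha)
    rw [zero_sub, inner_neg_left, inner_sub_right, real_inner_self_eq_norm_sq] at this
    linarith
  set g : Ω → Fin d → ℝ := fun ω => (hvG.mk v ω).ofLp with hg_def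
  have hg : StronglyMeasurable[G] g :=
    (PiLp.continuous_ofLp 2 _).comp_stronglyMeasurable hvG.stronglyMeasurable_mk
  have hvg : ∀ᵐ ω ∂μ, (v ω).ofLp = g ω := by
    filter_upwards [hvG.ae_eq_mk] with ω hω
    rw [hg_def, hω]
  set k : Ω → ℝ := fun ω => dot (g ω) (X ω) - ε * pNorm p (g ω) with hk_def
  have hkm : StronglyMeasurable[F] k :=
    (stronglyMeasurable_dot (hg.mono hGF) hXm).sub
      ((stronglyMeasurable_pNorm hp (hg.mono hGF)).const_mul ε)
  have hki : Integrable k μ := (integrable_penalised (ε := ε) hp hX v).congr (by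
    filter_upwards [hvg] with ω hω
    rw [hk_def, hω])
  have hposk : ∀ Z, IsWeight F Z → ‖v‖ ^ 2 ≤ ∫ ω, Z ω * k ω ∂μ := fun Z hZ => by
    refine (hpos Z hZ).trans_eq (integral_congr_ae ?_)
    filter_upwards [hvg] with ω hω
    rw [hk_def, hω]
  set s := {ω | k ω < 0} with hs_def
  have hs : MeasurableSet[F] s := hkm.measurableSet_lt stronglyMeasurable_const
  have hsi : Integrable (s.indicator k) μ := hki.indicator (hF _ hs)
  have hweight : ∀ n : ℕ,
      IsWeight F fun ω => 1 + n * s.indicator (fun _ => (1 : ℝ)) ω := fun n => by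
    refine ⟨measurable_const.add ((measurable_const.indicator hs).const_mul _), 1 + n, fun ω => ?_⟩
    by_cases hω : ω ∈ s <;> simp [hω]
  have hlin : ∀ n : ℕ, ‖v‖ ^ 2 ≤ ∫ ω, k ω ∂μ + n * ∫ ω, s.indicator k ω ∂μ := fun n => by
    refine (hposk _ (hweight n)).trans_eq ?_
    rw [← integral_const_mul, ← integral_add hki (hsi.const_mul _)]
    refine integral_congr_ae (.of_forall fun ω => ?_)
    by_cases hω : ω ∈ s <;> simp [hω, add_mul]
  have hneg : 0 ≤ -(s.indicator k) := fun ω => by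
    by_cases hω : ω ∈ s
    · have : k ω < 0 := hω
      simpa [hω] using this.le
    · simp [hω]
  have hint0 : ∫ ω, (-(s.indicator k)) ω ∂μ = 0 := by
    refine le_antisymm ?_ (integral_nonneg hneg)
    simp only [Pi.neg_apply, integral_neg]
    by_contra hlt
    obtain ⟨n, hn⟩ := exists_nat_gt ((∫ ω, k ω ∂μ) / -∫ ω, s.indicator k ω ∂μ)
    rw [div_lt_iff₀ (not_le.mp hlt)] at hn
    have := hlin n
    linarith
  rw [integral_eq_zero_iff_of_nonneg hneg hsi.neg] at hint0
  have hk0 := hna g hg (by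
    filter_upwards [hint0] with ω hω
    by_contra hlt
    have h1 : ω ∈ s := not_le.mp hlt
    have h2 : k ω = 0 := by simpa [h1] using hω
    exact hlt h2.ge)
  have := hposk _ hone
  simp only [one_mul] at this
  rw [integral_congr_ae (hk0 : k =ᵐ[μ] fun _ => 0), integral_zero] at this
  linarith

end OnePeriod

section Reweighting

variable {Ω : Type*} {G F mΩ : MeasurableSpace Ω} {μ : Measure Ω} {p ε : ℝ} {X : Ω → Fin d → ℝ}

lemma setIntegral_weight_mul_nonpos [IsFiniteMeasure μ] (hG : G ≤ mΩ) (hF : F ≤ mΩ) (hp : 1 ≤ p)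
    (hX : ∀ i, MemLp (fun ω => X ω i) 2 μ) {Z : Ω → ℝ} (hZ : IsWeight F Z)
    {a : Lp (EuclideanSpace ℝ (Fin d)) 2 μ}
    (ha : ∀ h : Lp (EuclideanSpace ℝ (Fin d)) 2 μ, AEStronglyMeasurable[G] h μ →
      ∫ ω, Z ω * (dot (h ω).ofLp (X ω) - ε * pNorm p (h ω).ofLp) ∂μ ≤ inner ℝ h a)
    {δ : ℝ} (hδ : 0 ≤ δ) {D : Set Ω} (hD : MeasurableSet[G] D)
    (haD : ∀ᵐ ω ∂μ, ω ∈ D → ∑ i, |(a ω).ofLp i| ≤ δ)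
    {h : Ω → Fin d → ℝ} (hh : StronglyMeasurable[G] h) (hC : ∃ C, ∀ ω, pNorm p (h ω) ≤ C) :
    ∫ ω in D, Z ω * (dot (h ω) (X ω) - (ε + δ) * pNorm p (h ω)) ∂μ ≤ 0 := by
  obtain ⟨C, hC⟩ := hC
  set g : Ω → Fin d → ℝ := D.indicator h with hg_def
  have hg : StronglyMeasurable[G] g := hh.indicator hD
  have hgC : ∀ ω, pNorm p (g ω) ≤ |C| := fun ω => by
    by_cases hω : ω ∈ D
    · simpa [hg_def, hω] using (hC ω).trans (le_abs_self C)
    · simp [hg_def, hω, pNorm_zero hp]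
  have hgi : ∀ i, MemLp (fun ω => g ω i) 2 μ := fun i =>
    MemLp.of_bound (stronglyMeasurable_apply (hg.mono hG) i).aestronglyMeasurable |C|
      (.of_forall fun ω => (abs_le_pNorm hp (g ω) i).trans (hgC ω))
  have hgL : MemLp (fun ω => WithLp.toLp 2 (g ω) : Ω → EuclideanSpace ℝ (Fin d)) 2 μ :=
    MemLp.of_eval_piLp hgi
  have hgG : AEStronglyMeasurable[G] hgL.toLp μ :=
    ((PiLp.continuous_toLp 2 _).comp_stronglyMeasurable hg).aestronglyMeasurable.congr
      hgL.coeFn_toLp.symm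
  have h1 := ha _ hgG
  rw [inner_eq_integral_dot] at h1
  have hgX : Integrable (fun ω => dot (g ω) (X ω)) μ := integrable_dot_of_memLp hgi hX
  have hgp : Integrable (fun ω => pNorm p (g ω)) μ := integrable_pNorm_of_memLp hp hgi
  have hga : Integrable (fun ω => dot (g ω) (a ω).ofLp) μ :=
    integrable_dot_of_memLp hgi (memLp_coord a)
  have e1 : ∫ ω, Z ω * (dot (hgL.toLp _ ω).ofLp (X ω) - ε * pNorm p (hgL.toLp _ ω).ofLp) ∂μ
      = ∫ ω, Z ω * (dot (g ω) (X ω) - ε * pNorm p (g ω)) ∂μ := integral_congr_ae (by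
    filter_upwards [hgL.coeFn_toLp] with ω hω
    rw [hω])
  have e2 : ∫ ω, dot (hgL.toLp _ ω).ofLp (a ω).ofLp ∂μ = ∫ ω, dot (g ω) (a ω).ofLp ∂μ :=
    integral_congr_ae (by
      filter_upwards [hgL.coeFn_toLp] with ω hω
      rw [hω])
  rw [e1, e2] at h1
  have h2 : ∫ ω, dot (g ω) (a ω).ofLp ∂μ ≤ ∫ ω, Z ω * (δ * pNorm p (g ω)) ∂μ := by
    refine integral_mono_ae hga (hZ.integrable_mul hF (hgp.const_mul δ)) ?_
    obtain ⟨-, C', hC'⟩ := hZ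
    filter_upwards [haD] with ω hω
    have hn := pNorm_nonneg p (g ω)
    calc dot (g ω) (a ω).ofLp ≤ (∑ i, |(a ω).ofLp i|) * pNorm p (g ω) :=
          dot_le_sum_abs_mul_pNorm hp _ _
      _ ≤ δ * pNorm p (g ω) := by
          by_cases hωD : ω ∈ D
          · exact mul_le_mul_of_nonneg_right (hω hωD) hn
          · simp [hg_def, hωD, pNorm_zero hp]
      _ ≤ Z ω * (δ * pNorm p (g ω)) :=
          le_mul_of_one_le_left (mul_nonneg hδ hn) (hC' ω).1
  have h3 : ∫ ω in D, Z ω * (dot (h ω) (X ω) - (ε + δ) * pNorm p (h ω)) ∂μ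
      = ∫ ω, Z ω * (dot (g ω) (X ω) - ε * pNorm p (g ω)) ∂μ
        - ∫ ω, Z ω * (δ * pNorm p (g ω)) ∂μ := by
    have hi : Integrable (fun ω => dot (g ω) (X ω) - ε * pNorm p (g ω)) μ :=
      hgX.sub (hgp.const_mul ε)
    rw [← integral_sub (hZ.integrable_mul hF hi)
      (hZ.integrable_mul hF (hgp.const_mul δ)), ← integral_indicator (hG _ hD)]
    refine integral_congr_ae (.of_forall fun ω => ?_)
    by_cases hω : ω ∈ D
    · simp only [hg_def, hω, Set.indicator_of_mem]
      ring
    · simp [hg_def, hω, pNorm_zero hp, dot]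
  linarith

/-- Measurable selection along a countable family: some `n` with a given property is chosen
measurably at almost every point. -/
lemma exists_measurable_nat {E : ℕ → Set Ω} (hE : ∀ n, MeasurableSet[G] (E n))
    (hae : ∀ᵐ ω ∂μ, ∃ n, ω ∈ E n) :
    ∃ N : Ω → ℕ, Measurable[G] N ∧ ∀ᵐ ω ∂μ, ω ∈ E (N ω) := by
  classical
  have hex : ∀ ω, ∃ n, ω ∈ E n ∪ (⋃ k, E k)ᶜ := fun ω => by
    by_cases h : ∃ n, ω ∈ E n
    · exact h.imp fun n hn => Or.inl hn
    · exact ⟨0, Or.inr (by simpa using h)⟩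
  refine ⟨fun ω => Nat.find (hex ω), measurable_find hex fun k =>
    (hE k).union (MeasurableSet.iUnion hE).compl, ?_⟩
  filter_upwards [hae] with ω hω
  rcases Nat.find_spec (hex ω) with h | h
  · exact h
  · exact absurd (Set.mem_iUnion.mpr hω) h

/-- One-period fundamental theorem, up to an arbitrarily small loss in the bound: absence of
penalised arbitrage yields a strictly positive bounded density making the increment satisfy the
gain bound. -/
lemma exists_reweighting [IsFiniteMeasure μ] (hGF : G ≤ F) (hF : F ≤ mΩ) (hp : 1 ≤ p)
    (hε : 0 ≤ ε) (hXm : StronglyMeasurable[F] X) (hX : ∀ i, MemLp (fun ω => X ω i) 2 μ)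
    (hna : ∀ h : Ω → Fin d → ℝ, StronglyMeasurable[G] h →
      (∀ᵐ ω ∂μ, 0 ≤ dot (h ω) (X ω) - ε * pNorm p (h ω)) →
      ∀ᵐ ω ∂μ, dot (h ω) (X ω) - ε * pNorm p (h ω) = 0) {δ : ℝ} (hδ : 0 < δ) :
    ∃ Z : Ω → ℝ, Measurable[F] Z ∧ (∀ ω, 0 < Z ω ∧ Z ω ≤ 1) ∧
      ∀ h : Ω → Fin d → ℝ, StronglyMeasurable[G] h → (∃ C, ∀ ω, pNorm p (h ω) ≤ C) →
        ∫ ω, Z ω * dot (h ω) (X ω) ∂μ ≤ (ε + δ) * ∫ ω, Z ω * pNorm p (h ω) ∂μ := by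
  have hG := hGF.trans hF
  obtain ⟨a', ha', hlim⟩ :=
    mem_closure_iff_seq_limit.mp (zero_mem_closure_dominators hGF hF hp hε hXm hX hna)
  obtain ⟨ns, -, hns⟩ := (tendstoInMeasure_of_tendsto_Lp hlim).exists_seq_tendsto_ae
  set a := fun n => a' (ns n) with ha_def
  have haG : ∀ n, AEStronglyMeasurable[G] (a n) μ := fun n => (ha' (ns n)).1
  choose Z hZ hZa using fun n => (ha' (ns n)).2
  choose C hC using fun n => (hZ n).2
  have hsum : Continuous fun x : EuclideanSpace ℝ (Fin d) => ∑ i, |x.ofLp i| := by fun_prop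
  set E : ℕ → Set Ω := fun n => {ω | ∑ i, |((haG n).mk _ ω).ofLp i| ≤ δ} with hE_def
  have hE : ∀ n, MeasurableSet[G] (E n) := fun n =>
    (hsum.comp_stronglyMeasurable (haG n).stronglyMeasurable_mk).measurableSet_le
      stronglyMeasurable_const
  have hmk : ∀ᵐ ω ∂μ, ∀ n, a n ω = (haG n).mk _ ω := ae_all_iff.mpr fun n => (haG n).ae_eq_mk
  obtain ⟨N, hN, hNE⟩ := exists_measurable_nat (μ := μ) hE (by
    filter_upwards [hns, hmk, Lp.coeFn_zero (EuclideanSpace ℝ (Fin d)) 2 μ] with ω h1 h2 h3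
    rw [h3] at h1
    have h4 := (hsum.tendsto _).comp h1
    have h5 := h4.eventually (gt_mem_nhds (a := δ) (by simpa using hδ))
    obtain ⟨n, hn⟩ := h5.exists
    refine ⟨n, ?_⟩
    have : ∑ i, |(a n ω).ofLp i| < δ := hn
    rw [h2 n] at this
    exact this.le)
  have hCpos : ∀ n, Ω → 0 < |C n| := fun n ω =>
    (by linarith [(hC n ω).1, (hC n ω).2] : 0 < C n).trans_le (le_abs_self _)
  have hZpos : ∀ n ω, 0 < Z n ω := fun n ω => by linarith [(hC n ω).1]
  set W : Ω → ℝ := fun ω => Z (N ω) ω / |C (N ω)| with hW_def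
  have hWm : Measurable[F] W := by
    have : Measurable[Prod.instMeasurableSpace (m₁ := ⊤) (m₂ := F)]
        fun x : ℕ × Ω => Z x.1 x.2 / |C x.1| :=
      measurable_from_prod_countable_right fun n => (hZ n).1.div_const |C n|
    exact this.comp ((hN.mono hGF le_rfl).prodMk measurable_id)
  have hW01 : ∀ ω, 0 < W ω ∧ W ω ≤ 1 := fun ω =>
    ⟨div_pos (hZpos _ _) (hCpos _ ω),
      (div_le_one (hCpos _ ω)).mpr ((hC _ ω).2.trans (le_abs_self _))⟩
  refine ⟨W, hWm, hW01, fun h hh hhC => ?_⟩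
  have hXi : ∀ i, Integrable (fun ω => X ω i) μ := fun i => (hX i).integrable one_le_two
  have hWi : ∀ f : Ω → ℝ, Integrable f μ → Integrable (fun ω => W ω * f ω) μ := fun f hf =>
    hf.bdd_mul (c := 1) (hWm.mono hF le_rfl).aestronglyMeasurable (.of_forall fun ω => by
      rw [Real.norm_of_nonneg (hW01 ω).1.le]
      exact (hW01 ω).2)
  obtain ⟨K, hK⟩ := id hhC
  have hid := integrable_dot hp (hh.mono hG) hK hXi
  have hin := integrable_pNorm (μ := μ) hp (hh.mono hG) hK
  set k : Ω → ℝ := fun ω => dot (h ω) (X ω) - (ε + δ) * pNorm p (h ω) with hk_def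
  have hki : Integrable k μ := hid.sub (hin.const_mul _)
  have hDm : ∀ n, MeasurableSet[G] (N ⁻¹' {n}) := fun n => hN (MeasurableSet.singleton n)
  have hU : ⋃ n, N ⁻¹' {n} = Set.univ := by
    ext ω
    simp
  have hs := hasSum_integral_iUnion (μ := μ) (fun n => hG _ (hDm n))
    (pairwise_disjoint_fiber N) (hWi k hki).integrableOn
  rw [hU, setIntegral_univ] at hs
  have hle : ∫ ω, W ω * k ω ∂μ ≤ 0 := hs.nonpos fun n => by
    have e : ∫ ω in N ⁻¹' {n}, W ω * k ω ∂μ = |C n|⁻¹ * ∫ ω in N ⁻¹' {n}, Z n ω * k ω ∂μ := by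
      rw [← integral_const_mul]
      refine setIntegral_congr_fun (hG _ (hDm n)) fun ω hω => ?_
      have hω : N ω = n := hω
      simp only [hW_def, hω]
      ring
    rw [e]
    refine mul_nonpos_of_nonneg_of_nonpos (inv_nonneg.mpr (abs_nonneg _)) ?_
    refine setIntegral_weight_mul_nonpos hG hF hp hX (hZ n) (hZa n) hδ.le (hDm n) ?_ hh hhC
    filter_upwards [hNE, hmk] with ω h1 h2 h3
    have h3 : N ω = n := h3
    rw [h3] at h1
    rw [h2 n]
    exact h1
  have e : ∫ ω, W ω * k ω ∂μ
      = ∫ ω, W ω * dot (h ω) (X ω) ∂μ - (ε + δ) * ∫ ω, W ω * pNorm p (h ω) ∂μ := by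
    rw [← integral_const_mul, ← integral_sub (hWi _ hid) ((hWi _ hin).const_mul _)]
    refine integral_congr_ae (.of_forall fun ω => ?_)
    simp only [hk_def]
    ring
  linarith

end Reweighting

section ChangeOfMeasure

lemma integral_withDensity_ofReal {μ : Measure Ω} {Z : Ω → ℝ} (hZ : Measurable Z)
    (h0 : ∀ ω, 0 ≤ Z ω) (f : Ω → ℝ) :
    ∫ ω, f ω ∂(μ.withDensity fun ω => ENNReal.ofReal (Z ω)) = ∫ ω, Z ω * f ω ∂μ := by
  rw [integral_withDensity_eq_integral_toReal_smul hZ.ennreal_ofReal (by simp)]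
  simp [ENNReal.toReal_ofReal (h0 _)]

lemma withDensity_ofReal_le {μ : Measure Ω} {Z : Ω → ℝ} (h1 : ∀ ω, Z ω ≤ 1) :
    μ.withDensity (fun ω => ENNReal.ofReal (Z ω)) ≤ μ :=
  (withDensity_mono (.of_forall fun ω => by simpa using h1 ω)).trans_eq withDensity_one

lemma absolutelyContinuous_withDensity_ofReal {μ : Measure Ω} {Z : Ω → ℝ} (hZ : Measurable Z)
    (h0 : ∀ ω, 0 < Z ω) : μ ≪ μ.withDensity fun ω => ENNReal.ofReal (Z ω) :=
  withDensity_absolutelyContinuous' hZ.ennreal_ofReal.aemeasurable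
    (.of_forall fun ω => by simpa using h0 ω)

lemma GainBound.withDensity {Ω : Type*} {G mΩ : MeasurableSpace Ω} (hG : G ≤ mΩ) {μ : Measure Ω}
    {X : Ω → Fin d → ℝ} {p ε : ℝ} (hp : 1 ≤ p) (h : GainBound μ G X p ε) {Z : Ω → ℝ}
    (hZ : Measurable[G] Z) (h01 : ∀ ω, 0 ≤ Z ω ∧ Z ω ≤ 1) :
    GainBound (μ.withDensity fun ω => ENNReal.ofReal (Z ω)) G X p ε := by
  rintro g hg ⟨C, hC⟩
  have hle : ∀ ω, pNorm p (Z ω • g ω) ≤ C := fun ω => by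
    rw [pNorm_smul hp (h01 ω).1]
    exact (mul_le_of_le_one_left (pNorm_nonneg _ _) (h01 ω).2).trans (hC ω)
  have h1 := h (fun ω => Z ω • g ω) (hZ.stronglyMeasurable.smul hg) ⟨C, hle⟩
  simp_rw [dot_smul_left, fun ω => pNorm_smul hp (h01 ω).1 (g ω)] at h1
  rwa [integral_withDensity_ofReal (hZ.mono hG le_rfl) fun ω => (h01 ω).1,
    integral_withDensity_ofReal (hZ.mono hG le_rfl) fun ω => (h01 ω).1]

lemma GainBound.smul {Ω : Type*} {G mΩ : MeasurableSpace Ω} {μ : Measure Ω}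
    {X : Ω → Fin d → ℝ} {p ε : ℝ} (h : GainBound μ G X p ε) (c : ℝ≥0∞) :
    GainBound (c • μ) G X p ε := by
  intro g hg hC
  rw [integral_smul_measure, integral_smul_measure, smul_eq_mul, smul_eq_mul, mul_left_comm]
  exact mul_le_mul_of_nonneg_left (h g hg hC) ENNReal.toReal_nonneg

/-- Without strict `ε`-arbitrage, no single-period position has a nonnegative and non-trivial
penalised gain. -/
lemma ae_eq_zero_of_not_exists_isStrictArb {P : Measure Ω} {ℱ : Filtration ℕ mΩ}
    {S : ℕ → Ω → Fin d → ℝ} {T : ℕ} {p ε : ℝ} (hp : 1 ≤ p)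
    (hna : ¬ ∃ H, IsStrictArb P ℱ S T p ε H) {t : ℕ} (h1 : 1 ≤ t) (hT : t ≤ T)
    {h : Ω → Fin d → ℝ} (hh : StronglyMeasurable[ℱ (t - 1)] h)
    (h0 : ∀ᵐ ω ∂P, 0 ≤ dot (h ω) (S t ω - S (t - 1) ω) - ε * pNorm p (h ω)) :
    ∀ᵐ ω ∂P, dot (h ω) (S t ω - S (t - 1) ω) - ε * pNorm p (h ω) = 0 := by
  set H : ℕ → Ω → Fin d → ℝ := fun s => if s = t then h else 0 with hH_def
  have ht : t ∈ Finset.Icc 1 T := Finset.mem_Icc.mpr ⟨h1, hT⟩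
  have hgain : ∀ ω, gain S H T ω = dot (h ω) (S t ω - S (t - 1) ω) := fun ω => by
    rw [gain, Finset.sum_eq_single_of_mem t ht fun s _ hs => by simp [hH_def, hs, dot]]
    simp [hH_def]
  have hnorm : ∀ ω, stratNorm p H T ω = pNorm p (h ω) := fun ω => by
    rw [stratNorm, Finset.sum_eq_single_of_mem t ht fun s _ hs => by
      simp [hH_def, hs, pNorm_zero hp]]
    simp [hH_def]
  have hH : IsStrategy ℱ H := fun s _ => by
    by_cases hs : s = t
    · subst hs
      simpa [hH_def] using hh
    · simp only [hH_def, hs, if_false]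
      exact stronglyMeasurable_zero
  by_contra hne
  refine hna ⟨H, hH, by simpa only [hgain, hnorm] using h0, ?_⟩
  simp only [hgain, hnorm]
  refine pos_iff_ne_zero.mpr fun hz => hne ?_
  rw [measure_eq_zero_iff_ae_notMem] at hz
  filter_upwards [h0, hz] with ω h2 h3
  exact le_antisymm (not_lt.mp h3) h2

lemma exists_measure_gainBound {P : Measure Ω} {ℱ : Filtration ℕ mΩ}
    {S : ℕ → Ω → Fin d → ℝ} (hS : Adapted ℱ S) {T : ℕ} {p ε δ : ℝ} (hp : 1 ≤ p) (hε : 0 ≤ ε)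
    (hδ : 0 < δ) (hna : ¬ ∃ H, IsStrictArb P ℱ S T p ε H) {μ₀ : Measure Ω} [IsFiniteMeasure μ₀]
    (hμP : μ₀ ≪ P) (hPμ : P ≪ μ₀)
    (hL2 : ∀ t ≤ T, ∀ i, MemLp (fun ω => S t ω i) 2 μ₀) (n : ℕ) (hn : n ≤ T) :
    ∃ μ ≤ μ₀, P ≪ μ ∧ ∀ t, T - n < t → t ≤ T →
      GainBound μ (ℱ (t - 1)) (fun ω => S t ω - S (t - 1) ω) p (ε + δ) := by
  induction n with
  | zero => exact ⟨μ₀, le_rfl, hPμ, fun t h1 h2 => by omega⟩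
  | succ n ih =>
    obtain ⟨μ, hμ, hPμ', hb⟩ := ih (by omega)
    have : IsFiniteMeasure μ := isFiniteMeasure_of_le μ₀ hμ
    obtain ⟨t, ht⟩ : ∃ t, t = T - n := ⟨_, rfl⟩
    have hSm : ∀ s ≤ t, StronglyMeasurable[ℱ t] (S s) := fun s hs =>
      ((hS s).mono (ℱ.mono hs) le_rfl).stronglyMeasurable
    obtain ⟨Z, hZm, hZ01, hZ⟩ := exists_reweighting (μ := μ) (G := ℱ (t - 1)) (F := ℱ t)
      (X := fun ω => S t ω - S (t - 1) ω) (ℱ.mono (Nat.sub_le t 1)) (ℱ.le t) hp hε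
      ((hSm t le_rfl).sub (hSm (t - 1) (Nat.sub_le t 1)))
      (fun i => ((hL2 t (by omega) i).sub (hL2 (t - 1) (by omega) i)).mono_measure hμ)
      (fun h hh h0 => ((Measure.absolutelyContinuous_of_le hμ).trans hμP).ae_le
        (ae_eq_zero_of_not_exists_isStrictArb hp hna (by omega) (by omega) hh (hPμ'.ae_le h0))) hδ
    have hZm' : Measurable Z := hZm.mono (ℱ.le t) le_rfl
    refine ⟨_, (withDensity_ofReal_le fun ω => (hZ01 ω).2).trans hμ,
      hPμ'.trans (absolutelyContinuous_withDensity_ofReal hZm' fun ω => (hZ01 ω).1), ?_⟩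
    intro s h1 h2
    rcases eq_or_ne s t with rfl | hst
    · intro h hh hC
      rw [integral_withDensity_ofReal hZm' fun ω => (hZ01 ω).1.le,
        integral_withDensity_ofReal hZm' fun ω => (hZ01 ω).1.le]
      exact hZ h hh hC
    · exact (hb s (by omega) h2).withDensity (ℱ.le _) hp
        (hZm.mono (ℱ.mono (by omega)) le_rfl) fun ω => ⟨(hZ01 ω).1.le, (hZ01 ω).2⟩

/-- Finitely many random vectors are square integrable under some equivalent finite measure with
density at most one. -/
lemma exists_measure_memLp (P : Measure Ω) [IsFiniteMeasure P] {S : ℕ → Ω → Fin d → ℝ}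
    (hS : ∀ t, Measurable (S t)) (T : ℕ) :
    ∃ μ ≤ P, P ≪ μ ∧ ∀ t ≤ T, ∀ i, MemLp (fun ω => S t ω i) 2 μ := by
  have hSi : ∀ t i, Measurable fun ω => S t ω i := fun t i => (measurable_pi_apply i).comp (hS t)
  set B : Ω → ℝ := fun ω => 1 + ∑ t ∈ Finset.range (T + 1), ∑ i, |S t ω i| with hB_def
  have hBm : Measurable B := measurable_const.add <|
    Finset.measurable_fun_sum _ fun t _ => Finset.measurable_fun_sum _ fun i _ => (hSi t i).abs
  have hB1 : ∀ ω, 1 ≤ B ω := fun ω => le_add_of_nonneg_right <|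
    Finset.sum_nonneg fun t _ => Finset.sum_nonneg fun i _ => abs_nonneg _
  have hSB : ∀ t ≤ T, ∀ i ω, |S t ω i| ≤ B ω := fun t ht i ω => by
    have h1 := Finset.single_le_sum (f := fun i => |S t ω i|) (fun i _ => abs_nonneg _)
      (Finset.mem_univ i)
    have h2 := Finset.single_le_sum (f := fun t => ∑ i, |S t ω i|)
      (fun t _ => Finset.sum_nonneg fun i _ => abs_nonneg _) (Finset.mem_range_succ_iff.mpr ht)
    exact (h1.trans h2).trans (le_add_of_nonneg_left zero_le_one)
  have hZm : Measurable fun ω => (B ω ^ 2)⁻¹ := (hBm.pow_const 2).inv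
  refine ⟨P.withDensity fun ω => ENNReal.ofReal (B ω ^ 2)⁻¹,
    withDensity_ofReal_le fun ω => inv_le_one_of_one_le₀ (one_le_pow₀ (hB1 ω)),
    absolutelyContinuous_withDensity_ofReal hZm fun ω =>
      inv_pos.mpr (pow_pos (by linarith [hB1 ω]) 2), fun t ht i => ?_⟩
  rw [memLp_two_iff_integrable_sq (hSi t i).aestronglyMeasurable,
    integrable_withDensity_iff hZm.ennreal_ofReal (by simp)]
  refine Integrable.of_bound (C := 1) (Measurable.aestronglyMeasurable (by fun_prop))
    (.of_forall fun ω => ?_)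
  have hB : 0 < B ω ^ 2 := pow_pos (by linarith [hB1 ω]) 2
  rw [ENNReal.toReal_ofReal (inv_nonneg.mpr hB.le), Real.norm_of_nonneg
    (mul_nonneg (sq_nonneg _) (inv_nonneg.mpr hB.le)), ← div_eq_mul_inv, div_le_one hB]
  exact sq_le_sq' (neg_le_of_abs_le (hSB t ht i ω)) (le_of_abs_le (hSB t ht i ω))

end ChangeOfMeasure

lemma Meps_nonempty_of_not_exists_isStrictArb {P : Measure Ω} [IsProbabilityMeasure P]
    {ℱ : Filtration ℕ mΩ} {S : ℕ → Ω → Fin d → ℝ} (hS : Adapted ℱ S) {T : ℕ} {p ε δ : ℝ}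
    (hp : 1 ≤ p) (hε : 0 ≤ ε) (hδ : 0 < δ) (hna : ¬ ∃ H, IsStrictArb P ℱ S T p ε H) :
    (Meps P ℱ S T p (ε + δ)).Nonempty := by
  obtain ⟨μ₀, hμ₀, hPμ₀, hL2⟩ :=
    exists_measure_memLp P (fun t => (hS t).mono (ℱ.le t) le_rfl) T
  have : IsFiniteMeasure μ₀ := isFiniteMeasure_of_le P hμ₀
  obtain ⟨μ, hμ, hPμ, hb⟩ := exists_measure_gainBound hS hp hε hδ hna
    (Measure.absolutelyContinuous_of_le hμ₀) hPμ₀ hL2 T le_rfl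
  have : IsFiniteMeasure μ := isFiniteMeasure_of_le μ₀ hμ
  have hμP : μ ≤ P := hμ.trans hμ₀
  have h0 : μ Set.univ ≠ 0 := fun h => by
    have := hPμ h
    simp at this
  have : NeZero μ := ⟨fun h => h0 (by simp [h])⟩
  have hc0 : (μ Set.univ)⁻¹ ≠ 0 := ENNReal.inv_ne_zero.mpr (measure_ne_top _ _)
  have hct : (μ Set.univ)⁻¹ ≠ ∞ := ENNReal.inv_ne_top.mpr h0
  have hQ : IsProbabilityMeasure ((μ Set.univ)⁻¹ • μ) := inferInstance
  have hSi : ∀ t ≤ T, Integrable (S t) ((μ Set.univ)⁻¹ • μ) := fun t ht =>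
    (Integrable.of_eval fun i => ((hL2 t ht i).integrable one_le_two).mono_measure hμ).smul_measure
      hct
  refine ⟨(μ Set.univ)⁻¹ • μ, ⟨hQ, (Measure.absolutelyContinuous_of_le hμP).smul_left _,
    hPμ.trans (Measure.absolutelyContinuous_smul hc0), hSi T le_rfl, fun t h1 h2 => ?_⟩,
    (μ Set.univ)⁻¹.toNNReal, ?_⟩
  · exact ((hb t (by omega) h2).smul _).qNorm_le (ℱ.le _) hp (by linarith) (hSi t h2)
      (hSi (t - 1) (by omega)) (hS (t - 1)).stronglyMeasurable
  · filter_upwards [Measure.rnDeriv_smul_left_of_ne_top μ P hct, Measure.rnDeriv_le_one_of_le hμP]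
      with ω h1 h2
    rw [h1, ENNReal.coe_toNNReal hct]
    exact mul_le_of_le_one_right' h2

/-- The critical value satisfies
`ε(P) = inf {ε ≥ 0 : 𝓜_ε(P) ≠ ∅}`, both infima taken in `[0,∞]` with `inf ∅ = ∞`. -/
theorem criticalValue_eq_inf_eps_martingale
    {Ω : Type*} [mΩ : MeasurableSpace Ω] {d T : ℕ}
    (P : Measure Ω) [IsProbabilityMeasure P] (ℱ : Filtration ℕ mΩ)
    (S : ℕ → Ω → Fin d → ℝ) (hS : Adapted ℱ S)
    (hd : 1 ≤ d) (hT : 1 ≤ T) (p : ℝ) (hp : 1 ≤ p) :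
    criticalValue P ℱ S T p =
      sInf {x : ℝ≥0∞ | ∃ ε : ℝ, 0 ≤ ε ∧ (Meps P ℱ S T p ε).Nonempty ∧ x = ENNReal.ofReal ε} := by
  refine le_antisymm (le_sInf ?_) (le_sInf ?_)
  · rintro _ ⟨ε, hε, ⟨Q, hQ, -⟩, rfl⟩
    refine ENNReal.le_of_forall_pos_le_add fun η hη _ => sInf_le ⟨ε + η, by positivity,
      hQ.not_exists_isStrictArb hS hp (le_add_of_nonneg_right η.coe_nonneg), ?_⟩
    rw [ENNReal.ofReal_add hε η.coe_nonneg, ENNReal.ofReal_coe_nnreal]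
  · rintro _ ⟨ε, hε, hna, rfl⟩
    refine ENNReal.le_of_forall_pos_le_add fun η hη _ => sInf_le ⟨ε + η, by positivity,
      Meps_nonempty_of_not_exists_isStrictArb hS hp hε.le hη hna, ?_⟩
    rw [ENNReal.ofReal_add hε.le η.coe_nonneg, ENNReal.ofReal_coe_nnreal]

end QFTAP
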